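/- arXiv:quant-ph/0509101 — 5 statements merged into one kernel-verified Lean document; each statement's English description precedes it below -/
import Mathlib

section
/- For j = 1, 2, let Φ_j and Φ̃_j be mutually complementary channels defined by isometries V_j : H_{A_j} → H_{B_j} ⊗ H_{C_j}. If the superadditivity Ĥ_{Φ_1 ⊗ Φ_2}(ρ_{12}) ≥ Ĥ_{Φ_1}(ρ_1) + Ĥ_{Φ_2}(ρ_2) holds for all density operators ρ_{12} on H_{A_1} ⊗ H_{A_2} (where ρ_1, ρ_2 are the partial traces of ρ_{12}), then the same superadditivity holds for the pair Φ̃_1, Φ̃_2. -/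
open Matrix
open scoped ComplexOrder

noncomputable section

/-- Partial trace over the second tensor factor. -/
def ptraceRight {B C : Type*} [Fintype C] (M : Matrix (B × C) (B × C) ℂ) :
    Matrix B B ℂ :=
  Matrix.of fun b b' => ∑ c, M (b, c) (b', c)

/-- Partial trace over the first tensor factor. -/
def ptraceLeft {B C : Type*} [Fintype B] (M : Matrix (B × C) (B × C) ℂ) :
    Matrix C C ℂ :=
  Matrix.of fun c c' => ∑ b, M (b, c) (b, c')

/-- A density operator: positive semidefinite with unit trace. -/
def IsDensity {n : Type*} [Fintype n] (ρ : Matrix n n ℂ) : Prop :=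
  ρ.PosSemidef ∧ ρ.trace = 1

/-- A pure state: a rank-one projection `|ψ⟩⟨ψ|` with `‖ψ‖ = 1`. -/
def IsPureState {n : Type*} [Fintype n] (ρ : Matrix n n ℂ) : Prop :=
  ∃ ψ : n → ℂ, (∑ i, star (ψ i) * ψ i) = 1 ∧ ρ = vecMulVec ψ (star ψ)

/-- The von Neumann entropy `H(σ) = -Tr σ log σ`, via the eigenvalues of the
Hermitian operator `σ`. -/
def vnEntropy {n : Type*} [Fintype n] [DecidableEq n] (σ : Matrix n n ℂ) : ℝ :=
  if h : σ.IsHermitian then ∑ i, Real.negMulLog (h.eigenvalues i) else 0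

/-- The convex closure `Ĥ_Φ(ρ)` of the output entropy of `Φ`. -/
def hatH {A B : Type*} [Fintype A] [Fintype B] [DecidableEq B]
    (Φ : Matrix A A ℂ → Matrix B B ℂ) (ρ : Matrix A A ℂ) : ℝ :=
  sInf {x : ℝ | ∃ (m : ℕ) (π : Fin m → ℝ) (σ : Fin m → Matrix A A ℂ),
    (∀ i, 0 ≤ π i) ∧ (∑ i, π i = 1) ∧ (∀ i, IsPureState (σ i)) ∧
    (ρ = ∑ i, (π i : ℂ) • σ i) ∧ x = ∑ i, π i * vnEntropy (Φ (σ i))}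

/-- The tensor product `Φ₁ ⊗ Φ₂` of two maps of matrix algebras. -/
def tensorMap {A1 A2 B1 B2 : Type*} [Fintype A1] [Fintype A2]
    (Φ1 : Matrix A1 A1 ℂ → Matrix B1 B1 ℂ) (Φ2 : Matrix A2 A2 ℂ → Matrix B2 B2 ℂ)
    (M : Matrix (A1 × A2) (A1 × A2) ℂ) : Matrix (B1 × B2) (B1 × B2) ℂ :=
  Matrix.of fun b b' =>
    Φ2 (Matrix.of fun a2 a2' =>
      Φ1 (Matrix.of fun a1 a1' => M (a1, a2) (a1', a2')) b.1 b'.1) b.2 b'.2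

theorem vnEntropy_eq_roots {n : Type*} [Fintype n] [DecidableEq n] {σ : Matrix n n ℂ}
    (h : σ.IsHermitian) :
    vnEntropy σ = (σ.charpoly.roots.map fun z => Real.negMulLog z.re).sum := by
  rw [vnEntropy, dif_pos h, h.roots_charpoly_eq_eigenvalues]
  simp

/-- The two reduced states of a pure bipartite state with coefficient matrix `N` have the same
entropy. -/
theorem vnEntropy_mul_conjTranspose {B C : Type*} [Fintype B] [Fintype C]
    [DecidableEq B] [DecidableEq C] (N : Matrix B C ℂ) :
    vnEntropy (N * Nᴴ) = vnEntropy (Nᵀ * Nᵀᴴ) := by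
  have hT : Nᵀ * Nᵀᴴ = (Nᴴ * N)ᵀ := by
    rw [transpose_mul]; rfl
  have hroots := congrArg (fun p => (p.roots.map fun z => Real.negMulLog z.re).sum)
    (charpoly_mul_comm' N Nᴴ)
  rw [vnEntropy_eq_roots (isHermitian_mul_conjTranspose_self N),
    vnEntropy_eq_roots (isHermitian_mul_conjTranspose_self Nᵀ), hT, charpoly_transpose]
  have hX (k : ℕ) : (Polynomial.X ^ k : Polynomial ℂ) ≠ 0 := pow_ne_zero _ Polynomial.X_ne_zero
  simpa [Polynomial.roots_mul, hX, (charpoly_monic _).ne_zero, Multiset.map_nsmul,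
    Multiset.sum_nsmul] using hroots

/-- The coefficient matrix of `V ψ` with respect to the product basis. -/
def coeffMatrix {A B C : Type*} [Fintype A] (V : Matrix (B × C) A ℂ) (ψ : A → ℂ) :
    Matrix B C ℂ :=
  Matrix.of fun b c => (V *ᵥ ψ) (b, c)

theorem conj_vecMulVec {A D : Type*} [Fintype A] (V : Matrix D A ℂ) (ψ : A → ℂ) :
    V * vecMulVec ψ (star ψ) * Vᴴ = vecMulVec (V *ᵥ ψ) (star (V *ᵥ ψ)) := by
  rw [mul_vecMulVec, vecMulVec_mul, star_mulVec]

theorem ptraceRight_conj_vecMulVec {A B C : Type*} [Fintype A] [Fintype C]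
    (V : Matrix (B × C) A ℂ) (ψ : A → ℂ) :
    ptraceRight (V * vecMulVec ψ (star ψ) * Vᴴ) = coeffMatrix V ψ * (coeffMatrix V ψ)ᴴ := by
  rw [conj_vecMulVec]
  ext b b'
  simp [ptraceRight, coeffMatrix, mul_apply, vecMulVec_apply]

theorem ptraceLeft_conj_vecMulVec {A B C : Type*} [Fintype A] [Fintype B]
    (V : Matrix (B × C) A ℂ) (ψ : A → ℂ) :
    ptraceLeft (V * vecMulVec ψ (star ψ) * Vᴴ) =
      (coeffMatrix V ψ)ᵀ * (coeffMatrix V ψ)ᵀᴴ := by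
  rw [conj_vecMulVec]
  ext c c'
  simp [ptraceLeft, coeffMatrix, mul_apply, vecMulVec_apply]

/-- The isometry `V₁ ⊗ V₂`, with output factors regrouped as `(B₁ ⊗ B₂) ⊗ (C₁ ⊗ C₂)`. -/
def tensorIsometry {A1 B1 C1 A2 B2 C2 : Type*}
    (V1 : Matrix (B1 × C1) A1 ℂ) (V2 : Matrix (B2 × C2) A2 ℂ) :
    Matrix ((B1 × B2) × (C1 × C2)) (A1 × A2) ℂ :=
  Matrix.of fun x a => V1 (x.1.1, x.2.1) a.1 * V2 (x.1.2, x.2.2) a.2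

theorem tensorIsometry_conj_apply {A1 B1 C1 A2 B2 C2 : Type*} [Fintype A1] [Fintype A2]
    (V1 : Matrix (B1 × C1) A1 ℂ) (V2 : Matrix (B2 × C2) A2 ℂ)
    (M : Matrix (A1 × A2) (A1 × A2) ℂ) (x y : (B1 × B2) × (C1 × C2)) :
    (tensorIsometry V1 V2 * M * (tensorIsometry V1 V2)ᴴ) x y =
      ∑ a2', (∑ a2, V2 (x.1.2, x.2.2) a2 * ∑ a1', (∑ a1, V1 (x.1.1, x.2.1) a1 *
        M (a1, a2) (a1', a2')) * star (V1 (y.1.1, y.2.1) a1')) *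
        star (V2 (y.1.2, y.2.2) a2') := by
  simp only [tensorIsometry, mul_apply, conjTranspose_apply, of_apply, Fintype.sum_prod_type,
    Finset.sum_mul, Finset.mul_sum, star_mul']
  rw [Finset.sum_comm]
  refine Finset.sum_congr rfl fun a2' _ => ?_
  simp only [← Finset.sum_product', Finset.univ_product_univ]
  refine Fintype.sum_equiv ⟨fun p => (p.2.2, p.1, p.2.1), fun p => (p.2.1, p.2.2, p.1),
    fun _ => rfl, fun _ => rfl⟩ _ _ fun p => ?_
  simp only [Equiv.coe_fn_mk]
  ring

theorem tensorMap_ptraceRight {A1 B1 C1 A2 B2 C2 : Type*}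
    [Fintype A1] [Fintype C1] [Fintype A2] [Fintype C2]
    (V1 : Matrix (B1 × C1) A1 ℂ) (V2 : Matrix (B2 × C2) A2 ℂ) :
    tensorMap (fun τ : Matrix A1 A1 ℂ => ptraceRight (V1 * τ * V1ᴴ))
      (fun τ : Matrix A2 A2 ℂ => ptraceRight (V2 * τ * V2ᴴ)) =
      fun τ => ptraceRight (tensorIsometry V1 V2 * τ * (tensorIsometry V1 V2)ᴴ) := by
  ext M b b'
  simp only [tensorMap, ptraceRight, of_apply, tensorIsometry_conj_apply, Fintype.sum_prod_type]
  rw [Finset.sum_comm]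
  refine Finset.sum_congr rfl fun c2 _ => ?_
  simp only [mul_apply, conjTranspose_apply, of_apply]
  rw [Finset.sum_comm]
  refine Finset.sum_congr rfl fun a2' _ => ?_
  rw [← Finset.sum_mul, Finset.sum_comm]
  simp only [Finset.mul_sum]

theorem tensorMap_ptraceLeft {A1 B1 C1 A2 B2 C2 : Type*}
    [Fintype A1] [Fintype B1] [Fintype A2] [Fintype B2]
    (V1 : Matrix (B1 × C1) A1 ℂ) (V2 : Matrix (B2 × C2) A2 ℂ) :
    tensorMap (fun τ : Matrix A1 A1 ℂ => ptraceLeft (V1 * τ * V1ᴴ))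
      (fun τ : Matrix A2 A2 ℂ => ptraceLeft (V2 * τ * V2ᴴ)) =
      fun τ => ptraceLeft (tensorIsometry V1 V2 * τ * (tensorIsometry V1 V2)ᴴ) := by
  ext M c c'
  simp only [tensorMap, ptraceLeft, of_apply, tensorIsometry_conj_apply, Fintype.sum_prod_type]
  rw [Finset.sum_comm]
  refine Finset.sum_congr rfl fun b2 _ => ?_
  simp only [mul_apply, conjTranspose_apply, of_apply]
  rw [Finset.sum_comm]
  refine Finset.sum_congr rfl fun a2' _ => ?_
  rw [← Finset.sum_mul, Finset.sum_comm]
  simp only [Finset.mul_sum]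

/-- Complementary channels have the same convex closure of the output entropy. -/
theorem hatH_ptraceLeft_eq_hatH_ptraceRight {A B C : Type*} [Fintype A] [Fintype B] [Fintype C]
    [DecidableEq B] [DecidableEq C] (V : Matrix (B × C) A ℂ) (ρ : Matrix A A ℂ) :
    hatH (fun τ => ptraceLeft (V * τ * Vᴴ)) ρ = hatH (fun τ => ptraceRight (V * τ * Vᴴ)) ρ := by
  have hpure (σ : Matrix A A ℂ) (hσ : IsPureState σ) :
      vnEntropy (ptraceLeft (V * σ * Vᴴ)) = vnEntropy (ptraceRight (V * σ * Vᴴ)) := by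
    obtain ⟨ψ, -, rfl⟩ := hσ
    rw [ptraceLeft_conj_vecMulVec, ptraceRight_conj_vecMulVec, ← vnEntropy_mul_conjTranspose]
  unfold hatH
  congr 1
  ext x
  refine exists_congr fun m => exists_congr fun π => exists_congr fun σ => ?_
  refine and_congr_right fun _ => and_congr_right fun _ => and_congr_right fun hσ =>
    and_congr_right fun _ => ?_
  simp only [hpure _ (hσ _)]

/-- If superadditivity of the convex closure of the output entropy holds for two
channels, then it holds for the pair of their complementary channels. -/
theorem hatH_superadditivity_of_complementary
    {A1 B1 C1 A2 B2 C2 : Type*}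
    [Fintype A1] [Fintype B1] [Fintype C1] [Fintype A2] [Fintype B2] [Fintype C2]
    [DecidableEq A1] [DecidableEq B1] [DecidableEq C1]
    [DecidableEq A2] [DecidableEq B2] [DecidableEq C2]
    (V1 : Matrix (B1 × C1) A1 ℂ) (hV1 : V1ᴴ * V1 = 1)
    (V2 : Matrix (B2 × C2) A2 ℂ) (hV2 : V2ᴴ * V2 = 1)
    (hsuper : ∀ ρ12 : Matrix (A1 × A2) (A1 × A2) ℂ, IsDensity ρ12 →
      hatH (tensorMap (fun τ => ptraceRight (V1 * τ * V1ᴴ))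
          (fun τ => ptraceRight (V2 * τ * V2ᴴ))) ρ12 ≥
        hatH (fun τ => ptraceRight (V1 * τ * V1ᴴ)) (ptraceRight ρ12) +
          hatH (fun τ => ptraceRight (V2 * τ * V2ᴴ)) (ptraceLeft ρ12)) :
    ∀ ρ12 : Matrix (A1 × A2) (A1 × A2) ℂ, IsDensity ρ12 →
      hatH (tensorMap (fun τ => ptraceLeft (V1 * τ * V1ᴴ))
          (fun τ => ptraceLeft (V2 * τ * V2ᴴ))) ρ12 ≥
        hatH (fun τ => ptraceLeft (V1 * τ * V1ᴴ)) (ptraceRight ρ12) +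
          hatH (fun τ => ptraceLeft (V2 * τ * V2ᴴ)) (ptraceLeft ρ12) := by
  intro ρ12 hρ
  have h := hsuper ρ12 hρ
  rw [tensorMap_ptraceRight] at h
  rw [tensorMap_ptraceLeft]
  simpa only [hatH_ptraceLeft_eq_hatH_ptraceRight] using h
end
end

section
/- Let Φ : M(H) → M(H') be an entanglement-breaking CP map, Φ(ρ) = Σ_{α=1}^{d̃} |φ_α⟩⟨ψ_α| ρ |ψ_α⟩⟨φ_α|, with vectors φ_α ∈ H' and ψ_α ∈ H. Then the map Φ̃ : M(H) → M_{d̃} given entrywise by Φ̃(ρ)_{αβ} = c_{αβ} ⟨ψ_α| ρ |ψ_β⟩, where c_{αβ} = ⟨φ_β|φ_α⟩, is complementary to Φ: there exists a linear operator V : H → H' ⊗ ℂ^{d̃} with Tr_{ℂ^{d̃}}(V ρ V*) = Φ(ρ) and Tr_{H'}(V ρ V*) = Φ̃(ρ) for all ρ. -/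
open Matrix
open scoped ComplexOrder

noncomputable section

/-- The map complementary to the entanglement-breaking CP map
`Φ(ρ) = Σ_α |φ_α⟩⟨ψ_α| ρ |ψ_α⟩⟨φ_α|` is
`Φ̃(ρ)_{αβ} = c_{αβ} ⟨ψ_α|ρ|ψ_β⟩` with `c_{αβ} = ⟨φ_β|φ_α⟩`. -/
theorem complementary_of_entanglement_breaking
    {H H' : Type*} [Fintype H] [Fintype H'] [DecidableEq H] [DecidableEq H']
    (dt : ℕ) (φ : Fin dt → H' → ℂ) (ψ : Fin dt → H → ℂ) :
    ∃ V : Matrix (H' × Fin dt) H ℂ,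
      ∀ ρ : Matrix H H ℂ,
        ptraceRight (V * ρ * Vᴴ) =
          ∑ α, vecMulVec (φ α) (star (ψ α)) * ρ * (vecMulVec (φ α) (star (ψ α)))ᴴ ∧
        ptraceLeft (V * ρ * Vᴴ) =
          Matrix.of (fun α β =>
            (∑ j, star (φ β j) * φ α j) * ((star (ψ α)) ⬝ᵥ (ρ *ᵥ ψ β))) := by
  refine ⟨Matrix.of fun p i => φ p.2 p.1 * star (ψ p.2 i), fun ρ => ⟨?_, ?_⟩⟩
  · ext b b'
    simp [ptraceRight, Matrix.sum_apply, Matrix.mul_apply, vecMulVec_apply, mul_comm (ψ _ _)]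
  · ext α β
    simp only [ptraceLeft, Matrix.mul_apply, conjTranspose_apply, of_apply, dotProduct, mulVec,
      Pi.star_apply, star_mul', star_star, Finset.sum_mul, Finset.mul_sum]
    rw [Finset.sum_comm_cycle]
    refine Finset.sum_congr rfl fun i _ => ?_
    rw [Finset.sum_comm]
    refine Finset.sum_congr rfl fun k _ => Finset.sum_congr rfl fun j _ => ?_
    ring
end
end

section
/- Let Φ_B : M(H_A) → M(H_B) be a CP map and let Φ_C : M(H_A) → M(H_C) and Φ_{C'} : M(H_A) → M(H_{C'}) be two CP maps complementary to Φ_B, arising from dilations V : H_A → H_B ⊗ H_C and V' : H_A → H_B ⊗ H_{C'}, where V is a minimal dilation (i.e., the vectors (X ⊗ I_C) V ψ, for ψ ∈ H_A and X ∈ M(H_B), span H_B ⊗ H_C). Then there exists a partial isometry W : H_C → H_{C'} such that Φ_{C'}(ρ) = W Φ_C(ρ) W* and Φ_C(ρ) = W* Φ_{C'}(ρ) W for all ρ ∈ M(H_A). -/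
open Matrix
open scoped ComplexOrder Kronecker

noncomputable section

/-- A completely positive map of matrix algebras: linear, and positivity is
preserved by all ampliations `Φ ⊗ Id_n`. -/
def IsCPMap {A B : Type*} [Fintype A] [Fintype B]
    (Φ : Matrix A A ℂ → Matrix B B ℂ) : Prop :=
  IsLinearMap ℂ Φ ∧
    ∀ (n : ℕ) (M : Matrix (A × Fin n) (A × Fin n) ℂ), M.PosSemidef →
      (Matrix.of fun bi bj : B × Fin n =>
        Φ (Matrix.of fun a a' => M (a, bi.2) (a', bj.2)) bi.1 bj.1).PosSemidef

/-- Matrices with equal Gram matrices, the first of full row rank, differ by an isometry. -/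
theorem exists_isometry_mul_eq_of_gram_eq {m n p : Type*} [Fintype m] [Fintype n] [Fintype p]
    [DecidableEq m] (K : Matrix m n ℂ) (K' : Matrix p n ℂ)
    (hK : Function.Injective K.vecMul) (h : Kᴴ * K = K'ᴴ * K') :
    ∃ W : Matrix p m ℂ, Wᴴ * W = 1 ∧ W * K = K' := by
  have hpos : (K * Kᴴ).PosDef := .mul_conjTranspose_self K hK
  have hdet : IsUnit (K * Kᴴ).det := (isUnit_iff_isUnit_det _).1 hpos.isUnit
  have hherm : ((K * Kᴴ)⁻¹)ᴴ = (K * Kᴴ)⁻¹ := hpos.isHermitian.inv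
  have hWK : K' * Kᴴ * (K * Kᴴ)⁻¹ * K = K' := by
    classical
    have hker : K * (Kᴴ * (K * Kᴴ)⁻¹ * K - 1) = 0 := by
      rw [Matrix.mul_sub, Matrix.mul_one, ← Matrix.mul_assoc, ← Matrix.mul_assoc,
        mul_nonsing_inv _ hdet, Matrix.one_mul, sub_self]
    have hker' : K' * (Kᴴ * (K * Kᴴ)⁻¹ * K - 1) = 0 := by
      rw [← conjTranspose_mul_self_mul_eq_zero, ← h, Matrix.mul_assoc, hker, Matrix.mul_zero]
    rw [Matrix.mul_sub, Matrix.mul_one, sub_eq_zero] at hker'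
    simpa only [Matrix.mul_assoc] using hker'
  refine ⟨K' * Kᴴ * (K * Kᴴ)⁻¹, ?_, hWK⟩
  calc (K' * Kᴴ * (K * Kᴴ)⁻¹)ᴴ * (K' * Kᴴ * (K * Kᴴ)⁻¹)
      = (K * Kᴴ)⁻¹ * K * (K'ᴴ * K') * Kᴴ * (K * Kᴴ)⁻¹ := by
        simp only [conjTranspose_mul, conjTranspose_conjTranspose, hherm, Matrix.mul_assoc]
    _ = (K * Kᴴ)⁻¹ * (K * Kᴴ) * ((K * Kᴴ) * (K * Kᴴ)⁻¹) := by
        rw [← h]; simp only [Matrix.mul_assoc]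
    _ = 1 := by rw [mul_nonsing_inv _ hdet, nonsing_inv_mul _ hdet, Matrix.one_mul]

/-- The matrix whose rows are the Kraus operators of a dilation, flattened. -/
def krausMatrix {A B C : Type*} (V : Matrix (B × C) A ℂ) : Matrix C (B × A) ℂ :=
  Matrix.of fun c ba => V (ba.1, c) ba.2

theorem ptraceLeft_eq_krausMatrix {A B C : Type*} [Fintype A] [Fintype B] [DecidableEq B]
    (V : Matrix (B × C) A ℂ) (ρ : Matrix A A ℂ) :
    ptraceLeft (V * ρ * Vᴴ) =
      krausMatrix V * ((1 : Matrix B B ℂ) ⊗ₖ ρ) * (krausMatrix V)ᴴ := by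
  ext c c'
  simp [ptraceLeft, krausMatrix, Matrix.mul_apply, Fintype.sum_prod_type, kroneckerMap_apply,
    Matrix.one_apply, Finset.sum_ite_irrel]

/-- The entries of the Gram matrix of the Kraus operators are values of the channel on matrix
units. -/
theorem krausMatrix_gram_apply {A B C : Type*} [Fintype A] [Fintype C] [DecidableEq A]
    (V : Matrix (B × C) A ℂ) (x y : B × A) :
    ((krausMatrix V)ᴴ * krausMatrix V) x y =
      ptraceRight (V * Matrix.single y.2 x.2 (1 : ℂ) * Vᴴ) y.1 x.1 := by
  simp [ptraceRight, krausMatrix, Matrix.mul_apply, Matrix.single_apply, ite_and, mul_comm]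

/-- The Kraus operators of a minimal dilation are linearly independent. -/
theorem krausMatrix_vecMul_injective {A B C : Type*} [Fintype A] [Fintype B] [Fintype C]
    [DecidableEq B] [DecidableEq C] [Nonempty B] (V : Matrix (B × C) A ℂ)
    (hmin : Submodule.span ℂ {v : B × C → ℂ | ∃ (X : Matrix B B ℂ) (ψ : A → ℂ),
        v = (X ⊗ₖ (1 : Matrix C C ℂ)) *ᵥ (V *ᵥ ψ)} = ⊤) :
    Function.Injective (krausMatrix V).vecMul := by
  refine (injective_iff_map_eq_zero (krausMatrix V).vecMulLinear).2 fun v hv => ?_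
  have hv' (b : B) (a : A) : ∑ c, v c * V (b, c) a = 0 := congrFun hv (b, a)
  have key (w : B × C → ℂ) (b : B) : ∑ c, v c * w (b, c) = 0 := by
    have hw : w ∈ Submodule.span ℂ {v : B × C → ℂ | ∃ (X : Matrix B B ℂ) (ψ : A → ℂ),
        v = (X ⊗ₖ (1 : Matrix C C ℂ)) *ᵥ (V *ᵥ ψ)} := hmin ▸ Submodule.mem_top
    induction hw using Submodule.span_induction with
    | mem w hw =>
      obtain ⟨X, ψ, rfl⟩ := hw
      calc ∑ c, v c * ((X ⊗ₖ (1 : Matrix C C ℂ)) *ᵥ (V *ᵥ ψ)) (b, c)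
          = ∑ c, ∑ b', ∑ a, X b b' * ψ a * (v c * V (b', c) a) := by
            simp only [mulVec, dotProduct, Fintype.sum_prod_type, kroneckerMap_apply,
              Matrix.one_apply, mul_ite, ite_mul, mul_one, mul_zero, zero_mul,
              Finset.sum_ite_eq, Finset.mem_univ, if_true]
            simp only [Finset.mul_sum]
            refine Finset.sum_congr rfl fun c _ => Finset.sum_congr rfl fun b' _ =>
              Finset.sum_congr rfl fun a _ => by ring
        _ = ∑ b', ∑ a, X b b' * ψ a * ∑ c, v c * V (b', c) a := by
            rw [Finset.sum_comm]
            refine Finset.sum_congr rfl fun b' _ => ?_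
            rw [Finset.sum_comm]
            simp only [Finset.mul_sum]
        _ = 0 := by simp [hv']
    | zero => simp
    | add x y _ _ hx hy => simp [mul_add, Finset.sum_add_distrib, hx, hy]
    | smul r x _ hx => simp [mul_left_comm, ← Finset.mul_sum, hx]
  obtain ⟨b⟩ := ‹Nonempty B›
  ext c
  simpa [Pi.single_apply] using key (Pi.single (b, c) 1) b

/-- Any two CP maps complementary to a given CP map `Φ_B`, one of them arising
from a minimal dilation, are equivalent via a partial isometry `W`. -/
theorem complementary_unique_up_to_partial_isometry
    {A B C C' : Type*} [Fintype A] [Fintype B] [Fintype C] [Fintype C']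
    [DecidableEq A] [DecidableEq B] [DecidableEq C] [DecidableEq C']
    (ΦB : Matrix A A ℂ → Matrix B B ℂ) (hΦB : IsCPMap ΦB)
    (V : Matrix (B × C) A ℂ) (V' : Matrix (B × C') A ℂ)
    (hV : ∀ ρ, ptraceRight (V * ρ * Vᴴ) = ΦB ρ)
    (hV' : ∀ ρ, ptraceRight (V' * ρ * V'ᴴ) = ΦB ρ)
    (hmin : Submodule.span ℂ {v : B × C → ℂ | ∃ (X : Matrix B B ℂ) (ψ : A → ℂ),
        v = (X ⊗ₖ (1 : Matrix C C ℂ)) *ᵥ (V *ᵥ ψ)} = ⊤) :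
    ∃ W : Matrix C' C ℂ, W * Wᴴ * W = W ∧
      ∀ ρ : Matrix A A ℂ,
        ptraceLeft (V' * ρ * V'ᴴ) = W * ptraceLeft (V * ρ * Vᴴ) * Wᴴ ∧
        ptraceLeft (V * ρ * Vᴴ) = Wᴴ * ptraceLeft (V' * ρ * V'ᴴ) * W := by
  rcases isEmpty_or_nonempty B with hB | hB
  · refine ⟨0, by simp, fun ρ => ⟨?_, ?_⟩⟩ <;> ext <;> simp [ptraceLeft]
  have hgram : (krausMatrix V)ᴴ * krausMatrix V = (krausMatrix V')ᴴ * krausMatrix V' := by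
    ext x y
    rw [krausMatrix_gram_apply, krausMatrix_gram_apply, hV, hV']
  obtain ⟨W, hW, hWK⟩ := exists_isometry_mul_eq_of_gram_eq _ _
    (krausMatrix_vecMul_injective V hmin) hgram
  have hWK' : Wᴴ * krausMatrix V' = krausMatrix V := by
    rw [← hWK, ← Matrix.mul_assoc, hW, Matrix.one_mul]
  refine ⟨W, by rw [Matrix.mul_assoc, hW, Matrix.mul_one], fun ρ => ⟨?_, ?_⟩⟩
  · rw [ptraceLeft_eq_krausMatrix, ptraceLeft_eq_krausMatrix, ← hWK]
    simp only [conjTranspose_mul, Matrix.mul_assoc]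
  · rw [ptraceLeft_eq_krausMatrix, ptraceLeft_eq_krausMatrix, ← hWK']
    simp only [conjTranspose_mul, conjTranspose_conjTranspose, Matrix.mul_assoc]
end
end

section
/- Let d ≥ 2, H = ℂ^d with orthonormal basis {e_j}, and let Φ be the extreme transpose-depolarizing channel Φ(ρ) = (1/(d−1))(I Tr ρ − ρ^T), where ρ^T is the transpose in the basis {e_j}. Let F be the flip operator on H ⊗ H (F(x ⊗ y) = y ⊗ x). Then the map Φ̃(ρ) = (1/(2(d−1))) (I − F)(ρ ⊗ I)(I − F) on H ⊗ H is a channel complementary to Φ: there exists an isometry V : H → H ⊗ (H ⊗ H) with Tr_{H⊗H}(V ρ V*) = Φ(ρ) and Tr_{H}(V ρ V*) = Φ̃(ρ) for all ρ, where the first partial trace is over the second tensor factor H ⊗ H and the second over the first factor H. -/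
open Matrix
open scoped ComplexOrder Kronecker

noncomputable section

/-- The flip operator on `ℂⁿ ⊗ ℂⁿ`. -/
def flipMatrix (n : Type*) [DecidableEq n] : Matrix (n × n) (n × n) ℂ :=
  Matrix.of fun x y => if x.1 = y.2 ∧ x.2 = y.1 then 1 else 0

theorem flipMatrix_mul_self (n : Type*) [DecidableEq n] [Fintype n] :
    flipMatrix n * flipMatrix n = 1 := by
  ext ⟨a, b⟩ ⟨a', b'⟩
  rw [Matrix.mul_apply, Finset.sum_eq_single (b, a)]
  · simp [flipMatrix, Matrix.one_apply, and_comm]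
  · rintro ⟨x, y⟩ - h
    have : ¬ (a = y ∧ b = x) := by
      rintro ⟨rfl, rfl⟩
      exact h rfl
    simp [flipMatrix, this]
  · simp

theorem conjTranspose_flipMatrix (n : Type*) [DecidableEq n] :
    (flipMatrix n)ᴴ = flipMatrix n := by
  ext ⟨a, b⟩ ⟨a', b'⟩
  simp only [flipMatrix, conjTranspose_apply, of_apply, apply_ite star, star_one, star_zero]
  congr 1
  simp only [eq_iff_iff]
  tauto

theorem star_one_sub_flipMatrix_apply {n : Type*} [DecidableEq n] (x y : n × n) :
    star ((1 - flipMatrix n) x y) = (1 - flipMatrix n) y x := by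
  rw [← conjTranspose_apply, conjTranspose_sub, conjTranspose_one, conjTranspose_flipMatrix]

theorem sum_one_sub_flipMatrix_mul {n : Type*} [DecidableEq n] [Fintype n] (x y : n × n) :
    ∑ c, (1 - flipMatrix n) x c * (1 - flipMatrix n) c y = 2 * (1 - flipMatrix n) x y := by
  have h : (1 - flipMatrix n) * (1 - flipMatrix n) = (2 : ℂ) • (1 - flipMatrix n) := by
    rw [sub_mul, mul_sub, mul_sub, flipMatrix_mul_self, two_smul]
    simp only [one_mul, mul_one]
    abel
  simpa [Matrix.mul_apply] using congrFun (congrFun h x) y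

/-- The matrix of `x ↦ s ∑ b, e_b ⊗ (1 - F)(x ⊗ e_b)`. -/
def antisymDilation (n : Type*) [DecidableEq n] (s : ℝ) : Matrix (n × (n × n)) n ℂ :=
  Matrix.of fun p a => (s : ℂ) * (1 - flipMatrix n) p.2 (a, p.1)

section antisymDilation

variable {n : Type*} [DecidableEq n] [Fintype n] (s : ℝ)

theorem antisymDilation_conjTranspose_mul_self :
    (antisymDilation n s)ᴴ * antisymDilation n s =
      (2 * (s : ℂ) ^ 2 * ((Fintype.card n : ℂ) - 1)) • (1 : Matrix n n ℂ) := by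
  ext a a'
  have h (b : n) : ∑ c, star (antisymDilation n s (b, c) a) * antisymDilation n s (b, c) a' =
      (s : ℂ) ^ 2 * (2 * (1 - flipMatrix n) (a, b) (a', b)) := by
    rw [← sum_one_sub_flipMatrix_mul, Finset.mul_sum]
    refine Finset.sum_congr rfl fun c _ => ?_
    simp only [antisymDilation, of_apply, star_mul', star_one_sub_flipMatrix_apply,
      Complex.star_def, Complex.conj_ofReal]
    ring
  rw [Matrix.mul_apply, Fintype.sum_prod_type]
  simp only [conjTranspose_apply, h]
  simp only [← Finset.mul_sum, Matrix.sub_apply, Finset.sum_sub_distrib]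
  by_cases haa : a = a'
  · subst haa
    simp [flipMatrix, ← eq_comm (a := a)]
    ring
  · have (b : n) : ¬ (a = b ∧ b = a') := fun h => haa (h.1.trans h.2)
    simp [flipMatrix, haa, this]

theorem antisymDilation_conj_apply (ρ : Matrix n n ℂ) (b b' : n) (c c' : n × n) :
    (antisymDilation n s * ρ * (antisymDilation n s)ᴴ) (b, c) (b', c') =
      (s : ℂ) ^ 2 * ∑ a', ∑ a, ρ a a' *
        ((1 - flipMatrix n) c (a, b) * (1 - flipMatrix n) (a', b') c') := by
  simp only [Matrix.mul_apply, Finset.sum_mul, Finset.mul_sum]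
  refine Finset.sum_congr rfl fun a' _ => Finset.sum_congr rfl fun a _ => ?_
  simp only [antisymDilation, conjTranspose_apply, of_apply, star_mul',
    star_one_sub_flipMatrix_apply, Complex.star_def, Complex.conj_ofReal]
  ring

theorem ptraceRight_antisymDilation (ρ : Matrix n n ℂ) :
    ptraceRight (antisymDilation n s * ρ * (antisymDilation n s)ᴴ) =
      (2 * (s : ℂ) ^ 2) • (ρ.trace • (1 : Matrix n n ℂ) - ρᵀ) := by
  ext b b'
  simp only [ptraceRight, of_apply, antisymDilation_conj_apply]
  rw [← Finset.mul_sum, Finset.sum_comm]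
  have h (a' : n) : ∑ c, ∑ a, ρ a a' *
      ((1 - flipMatrix n) c (a, b) * (1 - flipMatrix n) (a', b') c) =
      ∑ a, ρ a a' * (2 * (1 - flipMatrix n) (a', b') (a, b)) := by
    rw [Finset.sum_comm]
    refine Finset.sum_congr rfl fun a _ => ?_
    simp only [← Finset.mul_sum, ← sum_one_sub_flipMatrix_mul, mul_comm]
  simp only [h]
  simp only [Matrix.sub_apply, mul_sub, Finset.sum_sub_distrib]
  have h₁ : ∑ a', ∑ a, ρ a a' * (2 * (1 : Matrix (n × n) (n × n) ℂ) (a', b') (a, b)) =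
      2 * (ρ.trace * (1 : Matrix n n ℂ) b b') := by
    by_cases hb : b = b'
    · subst hb
      simp [Matrix.one_apply, Matrix.trace, ← Finset.sum_mul, mul_comm]
    · simp [hb, Ne.symm hb]
  have h₂ : ∑ a', ∑ a, ρ a a' * (2 * flipMatrix n (a', b') (a, b)) = 2 * ρ b' b := by
    simp [flipMatrix, ite_and, mul_comm]
  rw [h₁, h₂]
  simp only [Matrix.smul_apply, Matrix.sub_apply, transpose_apply, smul_eq_mul]
  ring

theorem ptraceLeft_antisymDilation (ρ : Matrix n n ℂ) :
    ptraceLeft (antisymDilation n s * ρ * (antisymDilation n s)ᴴ) =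
      (s : ℂ) ^ 2 •
        ((1 - flipMatrix n) * (ρ ⊗ₖ (1 : Matrix n n ℂ)) * (1 - flipMatrix n)) := by
  ext c c'
  simp only [ptraceLeft, of_apply, antisymDilation_conj_apply, Matrix.smul_apply, smul_eq_mul]
  rw [← Finset.mul_sum, Finset.sum_comm]
  congr 1
  simp only [Matrix.mul_apply, Fintype.sum_prod_type, kroneckerMap_apply, Finset.sum_mul]
  refine Finset.sum_congr rfl fun a' _ => Finset.sum_congr rfl fun b _ =>
    Finset.sum_congr rfl fun a _ => ?_
  rw [Finset.sum_eq_single b]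
  · rw [one_apply_eq]
    ring
  · intro b' _ hb
    simp [Matrix.one_apply, hb]
  · simp

end antisymDilation

/-- The channel `Φ̃(ρ) = (1/(2(d-1))) (I - F)(ρ ⊗ I)(I - F)`, where `F` is the
flip operator on `H ⊗ H`, is complementary to the extreme transpose-depolarizing
channel `Φ(ρ) = (1/(d-1))(I Tr ρ - ρ^T)`. -/
theorem complementary_of_transpose_depolarizing (d : ℕ) (hd : 2 ≤ d) :
    let Φ : Matrix (Fin d) (Fin d) ℂ → Matrix (Fin d) (Fin d) ℂ :=
      fun ρ => ((d : ℂ) - 1)⁻¹ • (ρ.trace • (1 : Matrix (Fin d) (Fin d) ℂ) - ρᵀ)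
    let F : Matrix (Fin d × Fin d) (Fin d × Fin d) ℂ :=
      Matrix.of fun x y => if x.1 = y.2 ∧ x.2 = y.1 then 1 else 0
    let Φt : Matrix (Fin d) (Fin d) ℂ → Matrix (Fin d × Fin d) (Fin d × Fin d) ℂ :=
      fun ρ => (2 * ((d : ℂ) - 1))⁻¹ •
        ((1 - F) * (ρ ⊗ₖ (1 : Matrix (Fin d) (Fin d) ℂ)) * (1 - F))
    ∃ V : Matrix (Fin d × (Fin d × Fin d)) (Fin d) ℂ,
      Vᴴ * V = 1 ∧
      ∀ ρ : Matrix (Fin d) (Fin d) ℂ,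
        ptraceRight (V * ρ * Vᴴ) = Φ ρ ∧ ptraceLeft (V * ρ * Vᴴ) = Φt ρ := by
  intro Φ F Φt
  have hd' : (0 : ℝ) < (d : ℝ) - 1 := by
    have : (2 : ℝ) ≤ d := by exact_mod_cast hd
    linarith
  have hne : (d : ℂ) - 1 ≠ 0 := by exact_mod_cast hd'.ne'
  obtain ⟨s, hs⟩ : ∃ s : ℝ, (s : ℂ) ^ 2 = (2 * ((d : ℂ) - 1))⁻¹ := by
    refine ⟨√(2 * ((d : ℝ) - 1))⁻¹, ?_⟩
    rw [← Complex.ofReal_pow, Real.sq_sqrt (by positivity)]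
    push_cast
    rfl
  refine ⟨antisymDilation (Fin d) s, ?_, fun ρ => ⟨?_, ?_⟩⟩
  · rw [antisymDilation_conjTranspose_mul_self, hs, Fintype.card_fin]
    convert one_smul ℂ (1 : Matrix (Fin d) (Fin d) ℂ) using 2
    field_simp
  · rw [ptraceRight_antisymDilation, hs]
    simp only [Φ]
    congr 1
    field_simp
  · rw [ptraceLeft_antisymDilation, hs]
    rfl
end
end

section
/- Let H = ℂ^d, 0 ≤ p ≤ d²/(d²−1), and let Φ be the depolarizing channel Φ(ρ) = (1−p)ρ + (p/d) I Tr ρ. Let |Ω⟩ = (1/√d) Σ_j e_j ⊗ e_j be the maximally entangled vector in H ⊗ H and set S = √(p/d) I_{12} + √d [ −√p/d + √(1 − p(d²−1)/d²) ] |Ω⟩⟨Ω|, a Hermitian operator on H ⊗ H. Then the map Φ̃(ρ) = S(ρ ⊗ I)S is a channel complementary to Φ: there exists an isometry V : H → H ⊗ (H ⊗ H) with Tr_{H⊗H}(V ρ V*) = Φ(ρ) and Tr_{H}(V ρ V*) = Φ̃(ρ) for all ρ. Moreover Φ̃ satisfies the covariance Φ̃(U ρ U*) = (U ⊗ Ū)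 Φ̃(ρ) (U ⊗ Ū)* for every unitary U on H, where Ū is the complex conjugate of U in the basis {e_j}. -/
open Matrix
open scoped ComplexOrder Kronecker

noncomputable section

/-- The Stinespring operator of `ρ ↦ S (ρ ⊗ I) Sᴴ`: a column of `S` indexed by `(k, b)` is read as
a map from the input index `k` to the output index `b` together with the row index of `S`. -/
def stinespring {A B C : Type*} (S : Matrix C (A × B) ℂ) : Matrix (B × C) A ℂ :=
  Matrix.of fun x k => S x.2 (k, x.1)

section stinespring

variable {A B C : Type*}

theorem stinespring_conjTranspose_mul_self_apply [Fintype B] [Fintype C]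
    (S : Matrix C (A × B) ℂ) (k l : A) :
    ((stinespring S)ᴴ * stinespring S) k l = ∑ b, (Sᴴ * S) (k, b) (l, b) := by
  simp [stinespring, Matrix.mul_apply, Fintype.sum_prod_type]

theorem ptraceLeft_stinespring [Fintype A] [Fintype B] [DecidableEq B]
    (S : Matrix C (A × B) ℂ) (ρ : Matrix A A ℂ) :
    ptraceLeft (stinespring S * ρ * (stinespring S)ᴴ) =
      S * (ρ ⊗ₖ (1 : Matrix B B ℂ)) * Sᴴ := by
  ext c c'
  simp only [ptraceLeft, stinespring, Matrix.mul_apply, Matrix.of_apply, conjTranspose_apply,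
    kroneckerMap_apply, Fintype.sum_prod_type, Matrix.one_apply, mul_ite, mul_one, mul_zero,
    Finset.sum_ite_eq', Finset.mem_univ, if_true]
  exact Finset.sum_comm

theorem ptraceRight_stinespring_apply [Fintype A] [Fintype C]
    (S : Matrix C (A × B) ℂ) (ρ : Matrix A A ℂ) (b b' : B) :
    ptraceRight (stinespring S * ρ * (stinespring S)ᴴ) b b' =
      ∑ l, ∑ k, ρ k l * (Sᴴ * S) (l, b') (k, b) := by
  simp only [ptraceRight, stinespring, Matrix.mul_apply, Matrix.of_apply, conjTranspose_apply,
    Finset.sum_mul, Finset.mul_sum]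
  rw [Finset.sum_comm]
  refine Finset.sum_congr rfl fun l _ => ?_
  rw [Finset.sum_comm]
  exact Finset.sum_congr rfl fun k _ => Finset.sum_congr rfl fun c _ => by ring

end stinespring

/-- The square of `a • 1 + b • P` for an idempotent `P`. -/
theorem sq_smul_one_add_smul_of_idempotent {n : Type*} [Fintype n] [DecidableEq n]
    {P : Matrix n n ℂ} (hP : P * P = P) (a b : ℂ) :
    (a • (1 : Matrix n n ℂ) + b • P) * (a • 1 + b • P) =
      (a ^ 2) • (1 : Matrix n n ℂ) + ((a + b) ^ 2 - a ^ 2) • P := by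
  simp only [Matrix.add_mul, Matrix.mul_add, Matrix.smul_mul, Matrix.mul_smul, Matrix.one_mul,
    Matrix.mul_one, hP]
  module

/-- `U ⊗ Ū` fixes every multiple of the maximally entangled vector. -/
theorem kronecker_conj_mulVec_diagonal {n : Type*} [Fintype n] [DecidableEq n]
    {U : Matrix n n ℂ} (hU : U * Uᴴ = 1) (c : ℂ) :
    (U ⊗ₖ U.map (starRingEnd ℂ)) *ᵥ (fun x : n × n => if x.1 = x.2 then c else 0) =
      fun x => if x.1 = x.2 then c else 0 := by
  ext ⟨i, j⟩
  have h := congrFun (congrFun hU i) j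
  simp only [Matrix.mul_apply, conjTranspose_apply, Matrix.one_apply] at h
  simp only [mulVec, dotProduct, kroneckerMap_apply, Matrix.map_apply, Fintype.sum_prod_type,
    mul_ite, mul_zero, Finset.sum_ite_eq, Finset.mem_univ, if_true, starRingEnd_apply]
  rw [← Finset.sum_mul, h]
  simp

theorem map_conj_mul_conjTranspose {n : Type*} [Fintype n] [DecidableEq n]
    {U : Matrix n n ℂ} (hU : U * Uᴴ = 1) :
    U.map (starRingEnd ℂ) * (U.map (starRingEnd ℂ))ᴴ = 1 := by
  have h := congrArg (fun M => M.map (starRingEnd ℂ)) hU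
  simp only [Matrix.map_mul] at h
  rw [Matrix.map_one _ (map_zero _) (map_one _)] at h
  exact h

theorem kronecker_conj_mul_conjTranspose {n : Type*} [Fintype n] [DecidableEq n]
    {U : Matrix n n ℂ} (hU : U * Uᴴ = 1) :
    (U ⊗ₖ U.map (starRingEnd ℂ)) * (U ⊗ₖ U.map (starRingEnd ℂ))ᴴ = 1 := by
  rw [conjTranspose_kronecker, ← mul_kronecker_mul, hU, map_conj_mul_conjTranspose hU,
    one_kronecker_one]

/-- A matrix `W` with `W Wᴴ = 1` fixing `v` commutes with `a • 1 + b • |v⟩⟨v|`. -/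
theorem commute_smul_one_add_smul_vecMulVec {n : Type*} [Fintype n] [DecidableEq n]
    {W : Matrix n n ℂ} (hW : W * Wᴴ = 1) {v : n → ℂ} (hv : W *ᵥ v = v) (a b : ℂ) :
    Commute W (a • (1 : Matrix n n ℂ) + b • vecMulVec v (star v)) := by
  have hW' : Wᴴ * W = 1 := mul_eq_one_comm.mp hW
  have hv' : star v ᵥ* W = star v := by
    have h : star v ᵥ* Wᴴ = star v := by rw [← star_mulVec, hv]
    calc star v ᵥ* W = (star v ᵥ* Wᴴ) ᵥ* W := by rw [h]
      _ = star v := by rw [vecMul_vecMul, hW', vecMul_one]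
  have : W * vecMulVec v (star v) = vecMulVec v (star v) * W := by
    rw [mul_vecMulVec, vecMulVec_mul, hv, hv']
  simp [Commute, SemiconjBy, Matrix.mul_add, Matrix.add_mul, this]

/-- The coefficients of the square of the operator defining the complementary channel. -/
theorem depolarizing_coefficients {d p : ℝ} (hd : 0 < d) (hp0 : 0 ≤ p)
    (hq : 0 ≤ 1 - p * ((d ^ 2 - 1) / d ^ 2)) :
    √(p / d) ^ 2 = p / d ∧
      (√(p / d) + √d * (-√p / d + √(1 - p * ((d ^ 2 - 1) / d ^ 2)))) ^ 2 - √(p / d) ^ 2 =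
        d * (1 - p) := by
  have h1 : √(p / d) ^ 2 = p / d := Real.sq_sqrt (by positivity)
  refine ⟨h1, ?_⟩
  have hs : √d ≠ 0 := (Real.sqrt_pos.mpr hd).ne'
  have h2 : √(p / d) = √d * (√p / d) := by
    rw [Real.sqrt_div hp0]
    field_simp
    rw [Real.sq_sqrt hd.le]
  have h3 : √(p / d) + √d * (-√p / d + √(1 - p * ((d ^ 2 - 1) / d ^ 2))) =
      √d * √(1 - p * ((d ^ 2 - 1) / d ^ 2)) := by
    rw [h2]
    ring
  rw [h3, mul_pow, Real.sq_sqrt hd.le, Real.sq_sqrt hq, h1]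
  field_simp
  ring

theorem depolarizing_parameter_bound {d : ℕ} (hd : 0 < d) {p : ℝ}
    (hp1 : p ≤ (d : ℝ) ^ 2 / ((d : ℝ) ^ 2 - 1)) :
    0 ≤ 1 - p * (((d : ℝ) ^ 2 - 1) / (d : ℝ) ^ 2) := by
  have hd1 : (1 : ℝ) ≤ d := by exact_mod_cast hd
  rcases hd1.eq_or_lt with h | h
  · simp [← h]
  · have h2 : 0 < (d : ℝ) ^ 2 - 1 := by nlinarith
    rw [le_div_iff₀ h2] at hp1
    rw [sub_nonneg, ← mul_div_assoc]
    exact div_le_one_of_le₀ hp1 (by positivity)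

/-- The map `Φ̃(ρ) = S(ρ ⊗ I)S`, with
`S = √(p/d) I + √d[-√p/d + √(1 - p(d²-1)/d²)] |Ω⟩⟨Ω|`, is a channel
complementary to the depolarizing channel `Φ(ρ) = (1-p)ρ + (p/d) I Tr ρ`, and it
is covariant in the sense `Φ̃(U ρ U*) = (U ⊗ Ū) Φ̃(ρ) (U ⊗ Ū)*`. -/
theorem complementary_of_depolarizing (d : ℕ) (hd : 0 < d) (p : ℝ)
    (hp0 : 0 ≤ p) (hp1 : p ≤ (d : ℝ) ^ 2 / ((d : ℝ) ^ 2 - 1)) :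
    let Φ : Matrix (Fin d) (Fin d) ℂ → Matrix (Fin d) (Fin d) ℂ :=
      fun ρ => (1 - (p : ℂ)) • ρ +
        ((p : ℂ) / (d : ℂ)) • ρ.trace • (1 : Matrix (Fin d) (Fin d) ℂ)
    let Ω : Fin d × Fin d → ℂ :=
      fun x => if x.1 = x.2 then ((Real.sqrt d)⁻¹ : ℝ) else 0
    let S : Matrix (Fin d × Fin d) (Fin d × Fin d) ℂ :=
      ((Real.sqrt (p / d) : ℝ) : ℂ) • (1 : Matrix (Fin d × Fin d) (Fin d × Fin d) ℂ) +
        ((Real.sqrt d * (-(Real.sqrt p) / d +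
            Real.sqrt (1 - p * (((d : ℝ) ^ 2 - 1) / (d : ℝ) ^ 2))) : ℝ) : ℂ) •
          vecMulVec Ω (star Ω)
    let Φt : Matrix (Fin d) (Fin d) ℂ → Matrix (Fin d × Fin d) (Fin d × Fin d) ℂ :=
      fun ρ => S * (ρ ⊗ₖ (1 : Matrix (Fin d) (Fin d) ℂ)) * S
    (∃ V : Matrix (Fin d × (Fin d × Fin d)) (Fin d) ℂ,
      Vᴴ * V = 1 ∧
      ∀ ρ : Matrix (Fin d) (Fin d) ℂ,
        ptraceRight (V * ρ * Vᴴ) = Φ ρ ∧ ptraceLeft (V * ρ * Vᴴ) = Φt ρ) ∧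
    (∀ U : Matrix (Fin d) (Fin d) ℂ, Uᴴ * U = 1 →
      ∀ ρ : Matrix (Fin d) (Fin d) ℂ,
        Φt (U * ρ * Uᴴ) =
          (U ⊗ₖ U.map (starRingEnd ℂ)) * Φt ρ * (U ⊗ₖ U.map (starRingEnd ℂ))ᴴ) := by
  intro Φ Ω S Φt
  have hdR : (0 : ℝ) < d := by exact_mod_cast hd
  have hdC : (d : ℂ) ≠ 0 := by exact_mod_cast hd.ne'
  have hstar : star Ω = Ω := by
    ext x
    simp only [Ω, Pi.star_apply]
    split_ifs <;> simp
  have hcc : (((√d)⁻¹ : ℝ) : ℂ) * (((√d)⁻¹ : ℝ) : ℂ) = (d : ℂ)⁻¹ := by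
    rw [← Complex.ofReal_mul, ← mul_inv, Real.mul_self_sqrt hdR.le]
    simp
  have hΩ : star Ω ⬝ᵥ Ω = 1 := by
    rw [hstar]
    simp only [Ω, dotProduct, Fintype.sum_prod_type, mul_ite, ite_mul, zero_mul, mul_zero, hcc]
    simp [hdC]
  have hP : vecMulVec Ω (star Ω) * vecMulVec Ω (star Ω) = vecMulVec Ω (star Ω) := by
    rw [vecMulVec_mul_vecMulVec, hΩ, one_smul]
  have hS : Sᴴ = S := by
    simp only [S, conjTranspose_add, conjTranspose_smul, conjTranspose_one,
      conjTranspose_vecMulVec, star_star]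
    simp
  obtain ⟨ha, hb⟩ := depolarizing_coefficients hdR hp0 (depolarizing_parameter_bound hd hp1)
  have hSS : Sᴴ * S = ((p : ℂ) / d) • (1 : Matrix (Fin d × Fin d) (Fin d × Fin d) ℂ) +
      ((d : ℂ) * (1 - p)) • vecMulVec Ω (star Ω) := by
    rw [hS, sq_smul_one_add_smul_of_idempotent hP]
    congr 2
    · exact_mod_cast ha
    · exact_mod_cast hb
  have hSS_apply (i j k l : Fin d) : (Sᴴ * S) (i, j) (k, l) =
      (p : ℂ) / d * (if i = k ∧ j = l then 1 else 0) +
        (1 - p) * (if i = j then if k = l then 1 else 0 else 0) := by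
    rw [hSS, hstar]
    simp only [Matrix.add_apply, Matrix.smul_apply, Matrix.one_apply, vecMulVec_apply, Ω,
      Prod.mk.injEq, smul_eq_mul]
    congr 1
    split_ifs <;> simp only [mul_zero, zero_mul, hcc]
    field_simp
  refine ⟨⟨stinespring S, ?_, fun ρ => ⟨?_, ?_⟩⟩, fun U hU ρ => ?_⟩
  · ext k l
    rw [stinespring_conjTranspose_mul_self_apply]
    simp only [hSS_apply, and_true, Finset.sum_add_distrib, ← Finset.mul_sum,
      Finset.sum_const, Finset.sum_ite_eq, Finset.mem_univ, if_true, Finset.card_univ,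
      Fintype.card_fin, nsmul_eq_mul, Matrix.one_apply]
    by_cases h : k = l
    · simp only [h, if_true]
      field_simp
      ring
    · simp [h, Ne.symm h]
  · ext b b'
    rw [ptraceRight_stinespring_apply]
    simp only [hSS_apply, Φ, Matrix.add_apply, Matrix.smul_apply, Matrix.one_apply,
      smul_eq_mul, mul_add, Finset.sum_add_distrib, Matrix.trace, Matrix.diag_apply]
    rw [add_comm]
    congr 1
    · simp [mul_comm]
    · by_cases h : b = b'
      · simp [h, ← Finset.sum_mul, mul_comm]
      · simp [h, Ne.symm h]
  · rw [ptraceLeft_stinespring, hS]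
  · have hU' : U * Uᴴ = 1 := mul_eq_one_comm.mp hU
    have hWS : Commute (U ⊗ₖ U.map (starRingEnd ℂ)) S :=
      commute_smul_one_add_smul_vecMulVec (kronecker_conj_mul_conjTranspose hU')
        (kronecker_conj_mulVec_diagonal hU' _) _ _
    have hSW : S * (U ⊗ₖ U.map (starRingEnd ℂ))ᴴ = (U ⊗ₖ U.map (starRingEnd ℂ))ᴴ * S := by
      have h := congrArg conjTranspose hWS.eq
      rwa [conjTranspose_mul, conjTranspose_mul, hS] at h
    have hρ : (U * ρ * Uᴴ) ⊗ₖ (1 : Matrix (Fin d) (Fin d) ℂ) =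
        (U ⊗ₖ U.map (starRingEnd ℂ)) * (ρ ⊗ₖ 1) * (U ⊗ₖ U.map (starRingEnd ℂ))ᴴ := by
      rw [conjTranspose_kronecker, ← mul_kronecker_mul, ← mul_kronecker_mul, Matrix.mul_one,
        map_conj_mul_conjTranspose hU']
    simp only [Φt]
    rw [hρ]
    simp only [Matrix.mul_assoc]
    rw [hSW]
    simp only [← Matrix.mul_assoc]
    rw [hWS.eq]
end
end
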